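/- arXiv:2508.17503 — 7 statements merged into one kernel-verified Lean document; each statement's English description precedes it below -/
import Mathlib

section
/- Let A ∈ ℝ^{n×n}, B ∈ ℝ^{n×1}, C ∈ ℝ^{1×n}, and let s_1, …, s_m ∈ ℂ be distinct points whose set {s_1,…,s_m} is closed under complex conjugation, with s_j I − A invertible for every j. Define V_m = (∏_{j=1}^m (s_j I − A)^{-1}) · [B, AB, …, A^{m−1}B] ∈ ℂ^{n×m} and W_m = ([C; CA; …; CA^{m−1}] · (∏_{j=1}^m (s_j I − A)^{-1}))ᵀ ∈ ℂ^{n×m}, and suppose T_m := W_mᵀ V_m is invertible. Define A_m = T_m^{-1} W_mᵀ A V_m, B_m = T_m^{-1} W_mᵀ B, C_m = C V_m. Then all entries of A_m, B_m, C_m are real, and for every i with s_i I_m − A_m invertible: C_m(s_i I_m − A_m)^{-1}B_m = C(s_i I_n − A)^{-1}B and C_m(s_i I_m − A_m)^{-2}B_m = C(s_i I_n − A)^{-2}B. -/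
open Matrix

open Polynomial in
/-- The polynomial `∏ (z - X)` over a list of points inverts the product of resolvents. -/
theorem resolvent_prod_mul_aeval {n : Type*} [Fintype n] [DecidableEq n]
    (a : Matrix n n ℂ) (l : List ℂ) (hl : ∀ z ∈ l, IsUnit (z • (1 : Matrix n n ℂ) - a)) :
    (l.map fun z => (z • (1 : Matrix n n ℂ) - a)⁻¹).prod *
      aeval a (l.map fun z => C z - X).prod = 1 := by
  induction l with
  | nil => simp
  | cons z l ih =>
    have ih' := ih fun w hw => hl w (List.mem_cons_of_mem _ hw)
    have hz := (Matrix.isUnit_iff_isUnit_det _).1 (hl z List.mem_cons_self)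
    have hX : aeval a (C z - X) = z • (1 : Matrix n n ℂ) - a := by
      simp [Algebra.algebraMap_eq_smul_one]
    rw [List.map_cons, List.map_cons, List.prod_cons, List.prod_cons,
      mul_comm (C z - X), map_mul, hX, mul_assoc, ← mul_assoc (List.prod _), ih', one_mul,
      Matrix.nonsing_inv_mul _ hz]

/-- The inverse of a matrix fixed by an entrywise ring endomorphism is fixed. -/
theorem map_eq_self_of_mul_eq_one {n : Type*} [Fintype n] [DecidableEq n]
    {M N : Matrix n n ℂ} (φ : ℂ →+* ℂ) (h : N * M = 1) (hM : M.map φ = M) : N.map φ = N := by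
  have h1 : N.map φ * M = 1 := by
    rw [← hM, ← Matrix.map_mul, h, Matrix.map_one _ (map_zero φ) (map_one φ)]
  calc N.map φ = N.map φ * (M * N) := by rw [mul_eq_one_comm.1 h, mul_one]
    _ = N := by rw [← mul_assoc, h1, one_mul]

/-- A polynomial in a real matrix with conjugation-invariant coefficients is real. -/
theorem aeval_map_conj {n : Type*} [Fintype n] [DecidableEq n] (A : Matrix n n ℝ)
    (q : Polynomial ℂ) (hq : q.map (starRingEnd ℂ) = q) :
    (Polynomial.aeval (A.map Complex.ofReal) q).map (starRingEnd ℂ) =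
      Polynomial.aeval (A.map Complex.ofReal) q := by
  have hA : (starRingEnd ℂ).mapMatrix (A.map Complex.ofReal) = A.map Complex.ofReal := by
    ext i j; simp
  have h : (starRingEnd ℂ).mapMatrix (Polynomial.aeval (A.map Complex.ofReal) q) =
      Polynomial.aeval (A.map Complex.ofReal) (q.map (starRingEnd ℂ)) := by
    rw [Polynomial.aeval_eq_sum_range, Polynomial.aeval_eq_sum_range, map_sum,
      Polynomial.natDegree_map]
    refine Finset.sum_congr rfl fun k _ => ?_
    have hk := map_pow (starRingEnd ℂ).mapMatrix (A.map Complex.ofReal) k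
    rw [hA] at hk
    rw [Polynomial.coeff_map]
    nth_rewrite 2 [← hk]
    ext i j
    simp
  rw [hq] at h
  exact h

/-- A family of points closed under conjugation has a conjugation-invariant
product `∏ (s j - X)`. -/
theorem prod_C_sub_X_map_conj {ι : Type*} [Fintype ι] (s : ι → ℂ) (hs : Function.Injective s)
    (hconj : ∀ j, ∃ k, s k = starRingEnd ℂ (s j)) :
    (∏ j, (Polynomial.C (s j) - Polynomial.X)).map (starRingEnd ℂ) =
      ∏ j, (Polynomial.C (s j) - Polynomial.X) := by
  choose σ hσ using hconj
  have hinj : Function.Injective σ := fun i j h => by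
    apply hs
    apply (starRingEnd ℂ).injective
    rw [← hσ, ← hσ, h]
  rw [Polynomial.map_prod]
  refine Fintype.prod_bijective σ (Finite.injective_iff_bijective.1 hinj) _ _ fun j => ?_
  simp [hσ]

/-- Galerkin projection: matching at `z` to first order, when the right and left resolvent
vectors lie in the trial and test spaces. -/
theorem projected_resolvent_eq {n m : Type*} [Fintype n] [DecidableEq n] [Fintype m]
    [DecidableEq m] {a : Matrix n n ℂ} {b : Matrix n (Fin 1) ℂ} {c : Matrix (Fin 1) n ℂ}
    {V : Matrix n m ℂ} {U : Matrix m n ℂ} {z : ℂ}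
    (hz : IsUnit (z • (1 : Matrix n n ℂ) - a)) (hT : IsUnit (U * V))
    {x : Matrix m (Fin 1) ℂ} (hx : (z • (1 : Matrix n n ℂ) - a)⁻¹ * b = V * x)
    {y : Matrix (Fin 1) m ℂ} (hy : c * (z • (1 : Matrix n n ℂ) - a)⁻¹ = y * U)
    (hzm : IsUnit (z • (1 : Matrix m m ℂ) - (U * V)⁻¹ * U * a * V)) :
    c * V * (z • (1 : Matrix m m ℂ) - (U * V)⁻¹ * U * a * V)⁻¹ * ((U * V)⁻¹ * U * b) =
      c * (z • (1 : Matrix n n ℂ) - a)⁻¹ * b ∧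
    c * V * (z • (1 : Matrix m m ℂ) - (U * V)⁻¹ * U * a * V)⁻¹ ^ 2 * ((U * V)⁻¹ * U * b) =
      c * (z • (1 : Matrix n n ℂ) - a)⁻¹ ^ 2 * b := by
  rw [Matrix.isUnit_iff_isUnit_det] at hz hT hzm
  have hR : U * (z • (1 : Matrix n n ℂ) - a) * V =
      (U * V) * (z • (1 : Matrix m m ℂ) - (U * V)⁻¹ * U * a * V) := by
    rw [Matrix.mul_sub (U * V), Matrix.mul_assoc _ U, Matrix.mul_assoc _ (U * a),
      Matrix.mul_nonsing_inv_cancel_left _ _ hT]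
    simp [Matrix.mul_sub, Matrix.sub_mul]
  set r := z • (1 : Matrix n n ℂ) - a
  set t := z • (1 : Matrix m m ℂ) - (U * V)⁻¹ * U * a * V
  have hxm : t⁻¹ * ((U * V)⁻¹ * U * b) = x := by
    have hb : b = r * (V * x) := by rw [← hx, Matrix.mul_nonsing_inv_cancel_left _ _ hz]
    have hUb : U * b = (U * V) * (t * x) := by
      rw [← Matrix.mul_assoc (U * V), ← hR, hb]
      simp only [Matrix.mul_assoc]
    rw [Matrix.mul_assoc _ U, hUb, Matrix.nonsing_inv_mul_cancel_left _ _ hT,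
      Matrix.nonsing_inv_mul_cancel_left _ _ hzm]
  have hym : c * V * t⁻¹ = y * (U * V) := by
    have hc : c = y * U * r := by rw [← hy, Matrix.nonsing_inv_mul_cancel_right _ _ hz]
    have hcV : c * V = y * (U * V) * t := by
      rw [Matrix.mul_assoc y (U * V), ← hR, hc]
      simp only [Matrix.mul_assoc]
    rw [hcV, Matrix.mul_nonsing_inv_cancel_right _ _ hzm]
  constructor
  · rw [Matrix.mul_assoc _ t⁻¹, hxm, Matrix.mul_assoc c, Matrix.mul_assoc c, hx]
  · calc c * V * t⁻¹ ^ 2 * ((U * V)⁻¹ * U * b)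
        = (c * V * t⁻¹) * (t⁻¹ * ((U * V)⁻¹ * U * b)) := by
          simp only [pow_two, Matrix.mul_assoc]
      _ = (y * U) * (V * x) := by rw [hym, hxm]; simp only [Matrix.mul_assoc]
      _ = c * r⁻¹ ^ 2 * b := by
          rw [← hx, ← hy]; simp only [pow_two, Matrix.mul_assoc]

/-- A polynomial of degree less than `m` in `a`, applied to `b`, is a combination of the columns
of the Krylov matrix. -/
theorem aeval_mul_eq_krylov_mul {n m : ℕ} (a : Matrix (Fin n) (Fin n) ℂ)
    (b : Matrix (Fin n) (Fin 1) ℂ) (q : Polynomial ℂ) (hq : q.natDegree < m) :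
    Polynomial.aeval a q * b =
      (Matrix.of fun i (j : Fin m) => (a ^ (j : ℕ) * b) i 0) *
        Matrix.of fun (j : Fin m) (_ : Fin 1) => q.coeff j := by
  rw [Polynomial.aeval_eq_sum_range' hq, ← Fin.sum_univ_eq_sum_range
    (fun k => q.coeff k • a ^ k), Matrix.sum_mul]
  ext i k
  obtain rfl := Subsingleton.elim k 0
  rw [Matrix.sum_apply, Matrix.mul_apply]
  simp [mul_comm]

/-- A row times a polynomial of degree less than `m` in `a` is a combination of the rows of the
Krylov matrix. -/
theorem mul_aeval_eq_mul_krylov {n m : ℕ} (a : Matrix (Fin n) (Fin n) ℂ)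
    (c : Matrix (Fin 1) (Fin n) ℂ) (q : Polynomial ℂ) (hq : q.natDegree < m) :
    c * Polynomial.aeval a q =
      (Matrix.of fun (_ : Fin 1) (j : Fin m) => q.coeff j) *
        Matrix.of fun (j : Fin m) i => (c * a ^ (j : ℕ)) 0 i := by
  rw [Polynomial.aeval_eq_sum_range' hq, ← Fin.sum_univ_eq_sum_range
    (fun k => q.coeff k • a ^ k), Matrix.mul_sum]
  ext k i
  obtain rfl := Subsingleton.elim k 0
  rw [Matrix.sum_apply, Matrix.mul_apply]
  simp


open Matrix

theorem stmt2 {n m : ℕ}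
    (A : Matrix (Fin n) (Fin n) ℝ) (B : Matrix (Fin n) (Fin 1) ℝ) (C : Matrix (Fin 1) (Fin n) ℝ)
    (s : Fin m → ℂ)
    (hdist : Function.Injective s)
    (hconj : ∀ j, ∃ k, s k = starRingEnd ℂ (s j))
    (hsinv : ∀ j, IsUnit (s j • (1 : Matrix (Fin n) (Fin n) ℂ) - A.map Complex.ofReal))
    -- the product ∏_{j=1}^m (s_j I − A)⁻¹ (the factors commute, so the order is immaterial)
    (Pprod : Matrix (Fin n) (Fin n) ℂ)
    (hPprod : Pprod =
      (List.ofFn fun j : Fin m =>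
        ((s j • (1 : Matrix (Fin n) (Fin n) ℂ) - A.map Complex.ofReal)⁻¹)).prod)
    -- V_m = (∏ (s_j I − A)⁻¹) · [B, AB, …, A^{m−1}B]
    (Vm : Matrix (Fin n) (Fin m) ℂ)
    (hVm : Vm = Pprod *
      (Matrix.of fun i (j : Fin m) =>
        (((A.map Complex.ofReal) ^ (j : ℕ)) * (B.map Complex.ofReal)) i 0))
    -- W_m = ([C; CA; …; CA^{m−1}] · (∏ (s_j I − A)⁻¹))ᵀ
    (Wm : Matrix (Fin n) (Fin m) ℂ)
    (hWm : Wm = ((Matrix.of fun (j : Fin m) i =>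
        ((C.map Complex.ofReal) * ((A.map Complex.ofReal) ^ (j : ℕ))) 0 i) * Pprod)ᵀ)
    (Tm : Matrix (Fin m) (Fin m) ℂ)
    (hTm : Tm = Wmᵀ * Vm)
    (hTminv : IsUnit Tm)
    (Am : Matrix (Fin m) (Fin m) ℂ) (Bm : Matrix (Fin m) (Fin 1) ℂ) (Cm : Matrix (Fin 1) (Fin m) ℂ)
    (hAm : Am = Tm⁻¹ * Wmᵀ * (A.map Complex.ofReal) * Vm)
    (hBm : Bm = Tm⁻¹ * Wmᵀ * (B.map Complex.ofReal))
    (hCm : Cm = (C.map Complex.ofReal) * Vm) :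
    (∀ i j, (Am i j).im = 0) ∧ (∀ i, (Bm i 0).im = 0) ∧ (∀ j, (Cm 0 j).im = 0) ∧
    (∀ i : Fin m, IsUnit (s i • (1 : Matrix (Fin m) (Fin m) ℂ) - Am) →
      (Cm * (s i • (1 : Matrix (Fin m) (Fin m) ℂ) - Am)⁻¹ * Bm) 0 0
          = ((C.map Complex.ofReal) *
              (s i • (1 : Matrix (Fin n) (Fin n) ℂ) - A.map Complex.ofReal)⁻¹ *
              (B.map Complex.ofReal)) 0 0 ∧
      (Cm * (((s i • (1 : Matrix (Fin m) (Fin m) ℂ) - Am)⁻¹ ^ 2 :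
            Matrix (Fin m) (Fin m) ℂ)) * Bm) 0 0
          = ((C.map Complex.ofReal) *
              (((s i • (1 : Matrix (Fin n) (Fin n) ℂ) - A.map Complex.ofReal)⁻¹ ^ 2 :
                Matrix (Fin n) (Fin n) ℂ)) *
              (B.map Complex.ofReal)) 0 0) := by
  set a : Matrix (Fin n) (Fin n) ℂ := A.map Complex.ofReal
  set q : Polynomial ℂ := ∏ j, (Polynomial.C (s j) - Polynomial.X)
  have hX (z : ℂ) : Polynomial.aeval a (Polynomial.C z - Polynomial.X) =
      z • (1 : Matrix (Fin n) (Fin n) ℂ) - a := by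
    simp [Algebra.algebraMap_eq_smul_one]
  have hPq : Pprod * Polynomial.aeval a q = 1 := by
    have h := resolvent_prod_mul_aeval a (List.ofFn s) (by simpa [List.mem_ofFn] using hsinv)
    rw [List.map_ofFn, List.map_ofFn, List.prod_ofFn (f := _ ∘ s)] at h
    rw [hPprod]
    exact h
  have hqP := mul_eq_one_comm.1 hPq
  have hconj_iff (w : ℂ) : starRingEnd ℂ w = w → w.im = 0 := Complex.conj_eq_iff_im.1
  have hmul {k l p : ℕ} {M : Matrix (Fin k) (Fin l) ℂ} {N : Matrix (Fin l) (Fin p) ℂ}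
      (hM : M.map (starRingEnd ℂ) = M) (hN : N.map (starRingEnd ℂ) = N) :
      (M * N).map (starRingEnd ℂ) = M * N := by
    rw [Matrix.map_mul, hM, hN]
  have hreal {k l : ℕ} (M : Matrix (Fin k) (Fin l) ℝ) :
      (M.map Complex.ofReal).map (starRingEnd ℂ) = M.map Complex.ofReal := by
    ext i j; simp
  have hpow (k : ℕ) : (a ^ k).map (starRingEnd ℂ) = a ^ k := by
    have h := map_pow (starRingEnd ℂ).mapMatrix a k
    rwa [RingHom.mapMatrix_apply, RingHom.mapMatrix_apply, hreal] at h
  have hP : Pprod.map (starRingEnd ℂ) = Pprod :=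
    map_eq_self_of_mul_eq_one _ hPq
      (aeval_map_conj A q (prod_C_sub_X_map_conj s hdist hconj))
  have hV : Vm.map (starRingEnd ℂ) = Vm := by
    rw [hVm]
    refine hmul hP ?_
    ext i j
    exact congrFun (congrFun (hmul (hpow j) (hreal B)) i) 0
  have hW : Wmᵀ.map (starRingEnd ℂ) = Wmᵀ := by
    rw [hWm, Matrix.transpose_transpose]
    refine hmul ?_ hP
    ext j i
    exact congrFun (congrFun (hmul (hreal C) (hpow j)) 0) i
  have hTi : Tm⁻¹.map (starRingEnd ℂ) = Tm⁻¹ :=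
    map_eq_self_of_mul_eq_one _
      (Matrix.nonsing_inv_mul _ ((Matrix.isUnit_iff_isUnit_det _).1 hTminv))
      (hTm ▸ hmul hW hV)
  refine ⟨fun i j => hconj_iff _ ?_, fun i => hconj_iff _ ?_, fun j => hconj_iff _ ?_,
    fun i hi => ?_⟩
  · rw [hAm]
    exact congrFun (congrFun (hmul (hmul (hmul hTi hW) (hreal A)) hV) i) j
  · rw [hBm]
    exact congrFun (congrFun (hmul (hmul hTi hW) (hreal B)) i) 0
  · rw [hCm]
    exact congrFun (congrFun (hmul (hreal C) hV) 0) j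
  · set p : Polynomial ℂ := ∏ j ∈ Finset.univ.erase i, (Polynomial.C (s j) - Polynomial.X)
    have hpq : p * (Polynomial.C (s i) - Polynomial.X) = q :=
      Finset.prod_erase_mul _ _ (Finset.mem_univ i)
    have hdeg : p.natDegree < m := by
      refine lt_of_le_of_lt ((Polynomial.natDegree_prod_le _ _).trans
        (Finset.sum_le_card_nsmul _ _ 1 fun j _ => ?_)) ?_
      · exact (Polynomial.natDegree_sub_le _ _).trans (by simp)
      · simpa using Nat.sub_lt i.pos Nat.one_pos
    have hl : (s i • (1 : Matrix (Fin n) (Fin n) ℂ) - a)⁻¹ = Pprod * Polynomial.aeval a p :=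
      Matrix.inv_eq_left_inv (by rw [mul_assoc, ← hX, ← map_mul, hpq, hPq])
    have hr : (s i • (1 : Matrix (Fin n) (Fin n) ℂ) - a)⁻¹ = Polynomial.aeval a p * Pprod :=
      Matrix.inv_eq_right_inv (by
        rw [← mul_assoc, ← hX, ← map_mul, mul_comm _ p, hpq, hqP])
    have hx := aeval_mul_eq_krylov_mul a (B.map Complex.ofReal) p hdeg
    have hy := mul_aeval_eq_mul_krylov a (C.map Complex.ofReal) p hdeg
    subst hTm hAm hBm hCm
    obtain ⟨h1, h2⟩ := projected_resolvent_eq (b := B.map Complex.ofReal)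
      (c := C.map Complex.ofReal) (hsinv i) hTminv
      (by rw [hl, Matrix.mul_assoc, hx, ← Matrix.mul_assoc, ← hVm])
      (by
        rw [hr, ← Matrix.mul_assoc, hy, Matrix.mul_assoc]
        rw [hWm, Matrix.transpose_transpose]) hi
    exact ⟨congrFun (congrFun h1 0) 0, congrFun (congrFun h2 0) 0⟩
end

section
/- Let A ∈ ℝ^{n×n} be invertible, B ∈ ℝ^{n×1}, C ∈ ℝ^{1×n}, and let p_1 ∈ ℝ be such that I − p_1 A^{-1} is invertible (equivalently p_1 I − A is invertible). Define T_4 = A^{-1}, T_6 = A^{-1} B Bᵀ A^{-T}, T_5 = −(T_6 T_4ᵀ + T_4 T_6ᵀ), and Δ̂ = p_1 (I − p_1 T_4)^{-1}. Then 2 C (p_1 I − A)^{-1} (p_1 B Bᵀ) (p_1 I − A)^{-T} Cᵀ = C Δ̂ T_6 Cᵀ + C T_6ᵀ Δ̂ᵀ Cᵀ − C Δ̂ T_5 Δ̂ᵀ Cᵀ (as scalars). -/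
open Matrix

theorem stmt4 {n : ℕ}
    (A : Matrix (Fin n) (Fin n) ℝ) (B : Matrix (Fin n) (Fin 1) ℝ) (C : Matrix (Fin 1) (Fin n) ℝ)
    (hA : IsUnit A) (p₁ : ℝ)
    (hp : IsUnit ((1 : Matrix (Fin n) (Fin n) ℝ) - p₁ • A⁻¹))
    (T₄ T₆ T₅ Δhat : Matrix (Fin n) (Fin n) ℝ)
    (hT₄ : T₄ = A⁻¹)
    (hT₆ : T₆ = A⁻¹ * B * Bᵀ * (A⁻¹)ᵀ)
    (hT₅ : T₅ = -(T₆ * T₄ᵀ + T₄ * T₆ᵀ))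
    (hΔhat : Δhat = p₁ • ((1 : Matrix (Fin n) (Fin n) ℝ) - p₁ • T₄)⁻¹) :
    2 * ((C * (p₁ • (1 : Matrix (Fin n) (Fin n) ℝ) - A)⁻¹ * (p₁ • (B * Bᵀ)) *
          ((p₁ • (1 : Matrix (Fin n) (Fin n) ℝ) - A)⁻¹)ᵀ * Cᵀ) 0 0)
      = (C * Δhat * T₆ * Cᵀ) 0 0 + (C * T₆ᵀ * Δhatᵀ * Cᵀ) 0 0
        - (C * Δhat * T₅ * Δhatᵀ * Cᵀ) 0 0 := by
  subst hT₄
  set T := A⁻¹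
  set R := ((1 : Matrix (Fin n) (Fin n) ℝ) - p₁ • T)⁻¹
  have hAdet : IsUnit A.det := (isUnit_iff_isUnit_det _).mp hA
  have hpdet := (isUnit_iff_isUnit_det _).mp hp
  have hRT : p₁ • (R * T) = R - 1 := by
    have h : R * (1 - p₁ • T) = 1 := nonsing_inv_mul _ hpdet
    rw [mul_sub, mul_one, mul_smul_comm, sub_eq_iff_eq_add] at h
    exact eq_sub_of_add_eq' h.symm
  have hRTt : p₁ • (Tᵀ * Rᵀ) = Rᵀ - 1 := by
    simpa using congrArg transpose hRT
  have hinv : (p₁ • (1 : Matrix (Fin n) (Fin n) ℝ) - A)⁻¹ = -(R * T) := by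
    refine inv_eq_left_inv ?_
    have hTA : R * T * A = R := by
      rw [mul_assoc, nonsing_inv_mul _ hAdet, mul_one]
    rw [neg_mul, mul_sub, mul_smul_comm, mul_one, hTA, hRT]
    abel
  have hsymm : T₆ᵀ = T₆ := by
    rw [hT₆]
    simp only [transpose_mul, transpose_transpose, Matrix.mul_assoc]
  have hleft : R * T * (p₁ • (B * Bᵀ)) * (R * T)ᵀ = p₁ • (R * T₆ * Rᵀ) := by
    rw [hT₆]
    simp only [transpose_mul, Matrix.mul_assoc, Matrix.mul_smul, Matrix.smul_mul]
  have hquad : Δhat * T₅ * Δhatᵀ =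
      Δhat * T₆ + T₆ * Δhatᵀ - (2 * p₁) • (R * T₆ * Rᵀ) := by
    have h₁ : Δhat * T₅ * Δhatᵀ =
        -(p₁ • (R * T₆ * (p₁ • (Tᵀ * Rᵀ))) + p₁ • ((p₁ • (R * T)) * T₆ * Rᵀ)) := by
      rw [hT₅, hΔhat, hsymm]
      simp only [transpose_smul, mul_neg, neg_mul, mul_add, add_mul,
        Matrix.mul_smul, Matrix.smul_mul, Matrix.mul_assoc]
    rw [h₁, hRT, hRTt, hΔhat]
    simp only [transpose_smul, mul_sub, sub_mul, mul_one, one_mul, smul_sub,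
      Matrix.mul_smul, Matrix.smul_mul]
    module
  have hmain : (2 : ℝ) • (C * (p₁ • (1 : Matrix (Fin n) (Fin n) ℝ) - A)⁻¹ * (p₁ • (B * Bᵀ)) *
        ((p₁ • (1 : Matrix (Fin n) (Fin n) ℝ) - A)⁻¹)ᵀ * Cᵀ) =
      C * Δhat * T₆ * Cᵀ + C * T₆ᵀ * Δhatᵀ * Cᵀ - C * Δhat * T₅ * Δhatᵀ * Cᵀ := by
    calc
      _ = C * ((2 : ℝ) • (R * T * (p₁ • (B * Bᵀ)) * (R * T)ᵀ)) * Cᵀ := by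
        rw [hinv]
        simp only [transpose_neg, Matrix.mul_neg, Matrix.neg_mul, smul_neg, neg_neg, Matrix.mul_smul,
          Matrix.smul_mul, Matrix.mul_assoc]
      _ = C * (Δhat * T₆ + T₆ * Δhatᵀ - Δhat * T₅ * Δhatᵀ) * Cᵀ := by
        rw [hleft, hquad, sub_sub_cancel, smul_smul]
      _ = _ := by
        rw [hsymm]
        simp only [Matrix.mul_sub, Matrix.mul_add, Matrix.sub_mul, Matrix.add_mul,
          Matrix.mul_assoc]
  simpa using congrFun (congrFun hmain 0) 0
end

section
/- Let A ∈ ℝ^{n×n} be Hurwitz (so A is invertible), B ∈ ℝ^{n×1}, C ∈ ℝ^{1×n}, and define T_2 = −C, T_4 = A^{-1}, T_6 = A^{-1} B Bᵀ A^{-T}, T_5 = −(T_6 T_4ᵀ + T_4 T_6ᵀ), T_3 = T_6 Cᵀ. Let γ ∈ ℝ and suppose there exists S ∈ ℝ^{n×n} such that S + Sᵀ ⪰ 0 and the symmetric matrix L = [[γ², T_3ᵀ − T_2 Sᵀ], [T_3 − S T_2ᵀ, −S T_4ᵀ − T_4 Sᵀ + T_5]] ∈ ℝ^{(n+1)×(n+1)}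 satisfies L ⪰ 0. Then for every p_1 > 0, f(p_1) := 2 C (p_1 I − A)^{-1} (p_1 B Bᵀ) (p_1 I − A)^{-T} Cᵀ ≤ γ². -/
open Matrix

/-- A real square matrix is Hurwitz if every complex eigenvalue has negative real part. -/
def IsHurwitz {k : ℕ} (M : Matrix (Fin k) (Fin k) ℝ) : Prop :=
  ∀ μ ∈ spectrum ℂ (M.map Complex.ofReal), μ.re < 0

/-- A Hurwitz matrix has no nonnegative real number in its spectrum. -/
theorem IsHurwitz.isUnit_det_smul_one_sub {k : ℕ} {M : Matrix (Fin k) (Fin k) ℝ}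
    (hM : IsHurwitz M) {p : ℝ} (hp : 0 ≤ p) :
    IsUnit (p • (1 : Matrix (Fin k) (Fin k) ℝ) - M).det := by
  have hres : (p : ℂ) ∉ spectrum ℂ (M.map Complex.ofReal) := fun h => by
    have hneg := hM _ h
    simp only [Complex.ofReal_re] at hneg
    linarith
  rw [spectrum.notMem_iff, Matrix.isUnit_iff_isUnit_det] at hres
  have hmap : algebraMap ℂ (Matrix (Fin k) (Fin k) ℂ) p - M.map Complex.ofReal =
      (p • (1 : Matrix (Fin k) (Fin k) ℝ) - M).map Complex.ofRealHom := by
    ext i j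
    by_cases hij : i = j <;> simp [Matrix.algebraMap_matrix_apply, hij]
  rw [hmap, ← RingHom.mapMatrix_apply, ← RingHom.map_det] at hres
  rw [isUnit_iff_ne_zero] at hres ⊢
  exact fun h => hres (by rw [h, map_zero])

theorem IsHurwitz.isUnit_det {k : ℕ} {M : Matrix (Fin k) (Fin k) ℝ} (hM : IsHurwitz M) :
    IsUnit M.det := by
  have h := hM.isUnit_det_smul_one_sub le_rfl
  rw [zero_smul, zero_sub, ← Matrix.isUnit_iff_isUnit_det, IsUnit.neg_iff] at h
  exact (Matrix.isUnit_iff_isUnit_det _).1 h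

/-- Congruence of the block matrix by `[1; p X]`, when `Tᵀ X = W` and `Cᵀ = p W - X`. -/
theorem fromRows_transpose_mul_fromBlocks_mul_fromRows {n : ℕ}
    (T S : Matrix (Fin n) (Fin n) ℝ) (B X W : Matrix (Fin n) (Fin 1) ℝ)
    (C : Matrix (Fin 1) (Fin n) ℝ) (G : Matrix (Fin 1) (Fin 1) ℝ) (p : ℝ)
    (hX : Tᵀ * X = W) (hC : C = p • Wᵀ - Xᵀ) :
    (fromRows (1 : Matrix (Fin 1) (Fin 1) ℝ) (p • X))ᵀ *
        fromBlocks G ((T * B * Bᵀ * Tᵀ * Cᵀ)ᵀ - -C * Sᵀ) (T * B * Bᵀ * Tᵀ * Cᵀ - S * (-C)ᵀ)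
          (-(S * Tᵀ) - T * Sᵀ +
            -(T * B * Bᵀ * Tᵀ * Tᵀ + T * (T * B * Bᵀ * Tᵀ)ᵀ)) *
        fromRows (1 : Matrix (Fin 1) (Fin 1) ℝ) (p • X) =
      G - (2 * p) • (Wᵀ * B * Bᵀ * W) - p • (Xᵀ * (S + Sᵀ) * X) := by
  have hXT : Xᵀ * T = Wᵀ := by rw [← hX, transpose_mul, transpose_transpose]
  have hXT' {m : ℕ} (M : Matrix (Fin n) (Fin m) ℝ) : Xᵀ * (T * M) = Wᵀ * M := by
    rw [← Matrix.mul_assoc, hXT]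
  rw [transpose_fromRows, fromCols_mul_fromBlocks, fromCols_mul_fromRows]
  subst hC
  simp only [transpose_mul, transpose_sub, transpose_smul, transpose_neg, transpose_one,
    transpose_transpose, Matrix.mul_assoc, Matrix.mul_add, Matrix.add_mul, Matrix.mul_sub,
    Matrix.sub_mul, Matrix.mul_neg, Matrix.neg_mul, Matrix.smul_mul, Matrix.mul_smul,
    Matrix.one_mul, Matrix.mul_one, hX, hXT']
  module

theorem stmt5 {n : ℕ}
    (A : Matrix (Fin n) (Fin n) ℝ) (B : Matrix (Fin n) (Fin 1) ℝ) (C : Matrix (Fin 1) (Fin n) ℝ)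
    (hA : IsHurwitz A)
    (T₂ : Matrix (Fin 1) (Fin n) ℝ) (T₄ T₆ T₅ : Matrix (Fin n) (Fin n) ℝ)
    (T₃ : Matrix (Fin n) (Fin 1) ℝ)
    (hT₂ : T₂ = -C)
    (hT₄ : T₄ = A⁻¹)
    (hT₆ : T₆ = A⁻¹ * B * Bᵀ * (A⁻¹)ᵀ)
    (hT₅ : T₅ = -(T₆ * T₄ᵀ + T₄ * T₆ᵀ))
    (hT₃ : T₃ = T₆ * Cᵀ)
    (γ : ℝ) (S : Matrix (Fin n) (Fin n) ℝ)
    (hS : (S + Sᵀ).PosSemidef)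
    (L : Matrix (Fin 1 ⊕ Fin n) (Fin 1 ⊕ Fin n) ℝ)
    (hL : L = Matrix.fromBlocks !![γ ^ 2] (T₃ᵀ - T₂ * Sᵀ) (T₃ - S * T₂ᵀ)
      (-(S * T₄ᵀ) - T₄ * Sᵀ + T₅))
    (hLpsd : L.PosSemidef) :
    ∀ p₁ : ℝ, 0 < p₁ →
      2 * ((C * (p₁ • (1 : Matrix (Fin n) (Fin n) ℝ) - A)⁻¹ * (p₁ • (B * Bᵀ)) *
            ((p₁ • (1 : Matrix (Fin n) (Fin n) ℝ) - A)⁻¹)ᵀ * Cᵀ) 0 0) ≤ γ ^ 2 := by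
  intro p hp
  set R := (p • (1 : Matrix (Fin n) (Fin n) ℝ) - A)⁻¹ with hR
  have hCR : C = p • (C * R) - C * R * A := by
    have h : C * R * (p • (1 : Matrix (Fin n) (Fin n) ℝ) - A) = C := by
      rw [Matrix.mul_assoc, hR, nonsing_inv_mul _ (hA.isUnit_det_smul_one_sub hp.le),
        Matrix.mul_one]
    rw [Matrix.mul_sub, Matrix.mul_smul, Matrix.mul_one] at h
    exact h.symm
  have hX : (A⁻¹)ᵀ * (C * R * A)ᵀ = (C * R)ᵀ := by
    rw [← transpose_mul, mul_nonsing_inv_cancel_right _ _ hA.isUnit_det]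
  have hZ := fromRows_transpose_mul_fromBlocks_mul_fromRows A⁻¹ S B (C * R * A)ᵀ (C * R)ᵀ C
    !![γ ^ 2] p hX (by simpa only [transpose_transpose] using hCR)
  have hLZ := hLpsd.conjTranspose_mul_mul_same
    (fromRows (1 : Matrix (Fin 1) (Fin 1) ℝ) (p • (C * R * A)ᵀ))
  subst hL hT₃ hT₅ hT₆ hT₄ hT₂
  rw [conjTranspose_eq_transpose_of_trivial, hZ] at hLZ
  have hL0 := hLZ.diag_nonneg (i := 0)
  have hS0 := (hS.conjTranspose_mul_mul_same (C * R * A)ᵀ).diag_nonneg (i := 0)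
  rw [conjTranspose_eq_transpose_of_trivial] at hS0
  have hf : C * R * (p • (B * Bᵀ)) * Rᵀ * Cᵀ = p • ((C * R)ᵀᵀ * B * Bᵀ * (C * R)ᵀ) := by
    simp only [transpose_transpose, transpose_mul, Matrix.mul_assoc, Matrix.smul_mul,
      Matrix.mul_smul]
  rw [hf]
  simp only [Matrix.sub_apply, Matrix.smul_apply, smul_eq_mul, of_apply,
    cons_val', cons_val_fin_one] at hL0 ⊢
  linarith [mul_nonneg hp.le hS0]
end

section
/- Let T_4 ∈ ℝ^{n×n}, let p_1 > 0 be such that I − p_1 T_4 is invertible, set Δ̂ = p_1 (I − p_1 T_4)^{-1}, and let S ∈ ℝ^{n×n} satisfy S + Sᵀ ⪰ 0. Then the symmetric matrix Δ̂ S + Sᵀ Δ̂ᵀ + Δ̂ (S T_4ᵀ + T_4 Sᵀ) Δ̂ᵀ is positive semidefinite. -/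
open Matrix

theorem stmt7 {n : ℕ}
    (T₄ : Matrix (Fin n) (Fin n) ℝ) (p₁ : ℝ) (hp₁ : 0 < p₁)
    (hinv : IsUnit ((1 : Matrix (Fin n) (Fin n) ℝ) - p₁ • T₄))
    (Δhat : Matrix (Fin n) (Fin n) ℝ)
    (hΔhat : Δhat = p₁ • ((1 : Matrix (Fin n) (Fin n) ℝ) - p₁ • T₄)⁻¹)
    (S : Matrix (Fin n) (Fin n) ℝ) (hS : (S + Sᵀ).PosSemidef) :
    (Δhat * S + Sᵀ * Δhatᵀ + Δhat * (S * T₄ᵀ + T₄ * Sᵀ) * Δhatᵀ).PosSemidef := by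
  have hmul : Δhat * (1 - p₁ • T₄) = p₁ • (1 : Matrix (Fin n) (Fin n) ℝ) := by
    rw [hΔhat, smul_mul_assoc, nonsing_inv_mul _ ((isUnit_iff_isUnit_det _).mp hinv)]
  have hT : Δhat * T₄ = p₁⁻¹ • Δhat - 1 := by
    have h := congrArg (p₁⁻¹ • ·) hmul
    simp only [mul_sub, mul_one, mul_smul_comm, smul_sub, inv_smul_smul₀ hp₁.ne'] at h
    rw [← h, sub_sub_cancel]
  have hTt : T₄ᵀ * Δhatᵀ = p₁⁻¹ • Δhatᵀ - 1 := by
    simpa using congrArg transpose hT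
  have key : Δhat * S + Sᵀ * Δhatᵀ + Δhat * (S * T₄ᵀ + T₄ * Sᵀ) * Δhatᵀ
      = Δhat * (p₁⁻¹ • (S + Sᵀ)) * Δhatᴴ := by
    calc
      _ = Δhat * S + Sᵀ * Δhatᵀ
          + (Δhat * S * (T₄ᵀ * Δhatᵀ) + Δhat * T₄ * Sᵀ * Δhatᵀ) := by noncomm_ring
      _ = _ := by
        rw [hT, hTt, conjTranspose_eq_transpose_of_trivial]
        simp only [mul_sub, sub_mul, mul_add, add_mul, mul_one, one_mul, mul_smul_comm,
          smul_mul_assoc, smul_add]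
        abel
  rw [key]
  exact (hS.smul (inv_nonneg.mpr hp₁.le)).mul_mul_conjTranspose_same Δhat
end

section
/- Let s_1, s_2 be distinct positive real numbers and g_1, g_2 ∈ ℝ. Let b_1, b_2 ∈ ℝ satisfy the linear system b_1/(2s_1) + b_2/(s_1+s_2) = g_1 and b_1/(s_1+s_2) + b_2/(2s_2) = g_2. Then b_1²/(2s_1) + 2 b_1 b_2/(s_1+s_2) + b_2²/(2s_2) = 2(s_1+s_2)·((s_1 g_1 − s_2 g_2)² + s_1 s_2 (g_1 − g_2)²)/(s_2 − s_1)². -/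
theorem stmt8 (s₁ s₂ : ℝ) (hs₁ : 0 < s₁) (hs₂ : 0 < s₂) (hne : s₁ ≠ s₂)
    (g₁ g₂ b₁ b₂ : ℝ)
    (h₁ : b₁ / (2 * s₁) + b₂ / (s₁ + s₂) = g₁)
    (h₂ : b₁ / (s₁ + s₂) + b₂ / (2 * s₂) = g₂) :
    b₁ ^ 2 / (2 * s₁) + 2 * (b₁ * b₂) / (s₁ + s₂) + b₂ ^ 2 / (2 * s₂)
      = 2 * (s₁ + s₂) * ((s₁ * g₁ - s₂ * g₂) ^ 2 + s₁ * s₂ * (g₁ - g₂) ^ 2)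
        / (s₂ - s₁) ^ 2 := by
  have hsum : s₁ + s₂ ≠ 0 := (add_pos hs₁ hs₂).ne'
  have hdiff : s₂ - s₁ ≠ 0 := sub_ne_zero.mpr hne.symm
  subst h₁ h₂
  field_simp
  ring
end

section
/- Let s_1 ∈ ℂ with Re(s_1) > 0 and Im(s_1) ≠ 0, set s_2 = conj(s_1), let g_1 ∈ ℂ and g_2 = conj(g_1). Let b_1, b_2 ∈ ℂ satisfy b_1/(2s_1) + b_2/(s_1+s_2) = g_1 and b_1/(s_1+s_2) + b_2/(2s_2) = g_2. Then b_1·conj(b_1)/(s_1+conj(s_1)) + b_1·conj(b_2)/(s_1+conj(s_2)) + conj(b_1)·b_2/(s_2+conj(s_1)) + b_2·conj(b_2)/(s_2+conj(s_2)) = −2(s_1+s_2)·(|s_1 g_1 − s_2 g_2|² + s_1 s_2 |g_1 − g_2|²)/(s_2 − s_1)². -/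
/-- Solution of the `2 × 2` Cauchy system with nodes `s`, `t`. -/
lemma cauchy_system_solution {s t g h b c : ℂ} (hs : s ≠ 0) (ht : t ≠ 0) (hst : s + t ≠ 0)
    (hd : t - s ≠ 0) (h₁ : b / (2 * s) + c / (s + t) = g) (h₂ : b / (s + t) + c / (2 * t) = h) :
    b = 2 * s * (s + t) * ((s + t) * g - 2 * t * h) / (t - s) ^ 2 := by
  rw [← h₁, ← h₂]
  field_simp
  ring

theorem stmt9 (s₁ : ℂ) (hre : 0 < s₁.re) (him : s₁.im ≠ 0)
    (s₂ : ℂ) (hs₂ : s₂ = starRingEnd ℂ s₁)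
    (g₁ g₂ : ℂ) (hg₂ : g₂ = starRingEnd ℂ g₁)
    (b₁ b₂ : ℂ)
    (h₁ : b₁ / (2 * s₁) + b₂ / (s₁ + s₂) = g₁)
    (h₂ : b₁ / (s₁ + s₂) + b₂ / (2 * s₂) = g₂) :
    b₁ * starRingEnd ℂ b₁ / (s₁ + starRingEnd ℂ s₁)
      + b₁ * starRingEnd ℂ b₂ / (s₁ + starRingEnd ℂ s₂)
      + starRingEnd ℂ b₁ * b₂ / (s₂ + starRingEnd ℂ s₁)
      + b₂ * starRingEnd ℂ b₂ / (s₂ + starRingEnd ℂ s₂)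
      = -2 * (s₁ + s₂) *
          ((s₁ * g₁ - s₂ * g₂) * starRingEnd ℂ (s₁ * g₁ - s₂ * g₂)
            + s₁ * s₂ * ((g₁ - g₂) * starRingEnd ℂ (g₁ - g₂)))
        / (s₂ - s₁) ^ 2 := by
  have hc₂ : starRingEnd ℂ s₂ = s₁ := by rw [hs₂, Complex.conj_conj]
  have hcg₂ : starRingEnd ℂ g₂ = g₁ := by rw [hg₂, Complex.conj_conj]
  have hs₁0 : s₁ ≠ 0 := fun h => by simp [h] at hre
  have hs₂0 : s₂ ≠ 0 := fun h => by rw [h, map_zero] at hc₂; exact hs₁0 hc₂.symm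
  have hsum : s₁ + s₂ ≠ 0 := fun h => by
    have := congrArg Complex.re h
    simp only [hs₂, Complex.add_re, Complex.conj_re, Complex.zero_re] at this
    linarith
  have hsub : s₂ - s₁ ≠ 0 := fun h => by
    have := congrArg Complex.im h
    simp only [hs₂, Complex.sub_im, Complex.conj_im, Complex.zero_im] at this
    exact him (by linarith)
  have hsub' : s₁ - s₂ ≠ 0 := fun h => hsub (by linear_combination -h)
  have hb₁ := cauchy_system_solution hs₁0 hs₂0 hsum hsub h₁ h₂
  have hb₂ := cauchy_system_solution (b := b₂) (c := b₁) (g := g₂) (h := g₁) hs₂0 hs₁0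
    (by rwa [add_comm]) hsub' (by rw [← h₂, add_comm s₂]; ring) (by rw [← h₁, add_comm s₂]; ring)
  have hcb₁ : starRingEnd ℂ b₁ = b₂ := by
    rw [hb₁, hb₂]
    simp only [map_div₀, map_mul, map_add, map_sub, map_pow, map_ofNat, ← hs₂, ← hg₂, hc₂, hcg₂]
  have hcb₂ : starRingEnd ℂ b₂ = b₁ := by rw [← hcb₁, Complex.conj_conj]
  simp only [map_sub, map_mul, hcb₁, hcb₂, hc₂, hcg₂, ← hs₂, ← hg₂]
  calc
    _ = b₁ * (b₁ / (2 * s₁) + b₂ / (s₁ + s₂)) + b₂ * (b₁ / (s₁ + s₂) + b₂ / (2 * s₂)) := by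
      rw [← two_mul s₁, ← two_mul s₂, add_comm s₂ s₁]
      ring
    _ = b₁ * g₁ + b₂ * g₂ := by rw [h₁, h₂]
    _ = _ := by
      rw [hb₁, hb₂, ← neg_sub s₂ s₁, neg_sq]
      field_simp
      ring
end

section
/- Let A ∈ ℝ^{n×n}, B ∈ ℝ^{n×1}, C ∈ ℝ^{1×n}, and let s_1, s_2 ∈ ℂ be distinct with s_1 I − A and s_2 I − A invertible (over ℂ). Set g_i = C(s_i I − A)^{-1}B ∈ ℂ and 𝒜₂ = (s_1 I − A)(s_2 I − A). Then 2(s_1+s_2)·((s_1 g_1 − s_2 g_2)² + s_1 s_2 (g_1 − g_2)²)/(s_2 − s_1)² = 2(s_1+s_2) · C 𝒜₂^{-1} (s_1 s_2 B Bᵀ + A B Bᵀ Aᵀ) 𝒜₂^{-T} Cᵀ. -/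
open Matrix

section ShiftedInverse

variable {n K : Type*} [Fintype n] [DecidableEq n] [Field K]
  {A : Matrix n n K} {s t : K}

/-- The resolvent identity for matrices, with the product of the shifts inverted as a whole. -/
theorem Matrix.shifted_inv_sub_inv (hs : IsUnit (s • (1 : Matrix n n K) - A))
    (ht : IsUnit (t • (1 : Matrix n n K) - A)) :
    (s • (1 : Matrix n n K) - A)⁻¹ - (t • (1 : Matrix n n K) - A)⁻¹ =
      (t - s) • ((s • (1 : Matrix n n K) - A) * (t • (1 : Matrix n n K) - A))⁻¹ := by
  have hd : (t - s) • (1 : Matrix n n K) =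
      (t • (1 : Matrix n n K) - A) - (s • (1 : Matrix n n K) - A) := by
    rw [sub_smul]; abel
  rw [Matrix.isUnit_iff_isUnit_det] at hs ht
  rw [Matrix.mul_inv_rev]
  generalize s • (1 : Matrix n n K) - A = M at *
  generalize t • (1 : Matrix n n K) - A = N at *
  calc M⁻¹ - N⁻¹ = N⁻¹ * (N - M) * M⁻¹ := by
        rw [mul_sub, sub_mul, Matrix.nonsing_inv_mul _ ht, one_mul, mul_assoc,
          Matrix.mul_nonsing_inv _ hs, mul_one]
    _ = (t - s) • (N⁻¹ * M⁻¹) := by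
        rw [← hd, Matrix.mul_smul, mul_one, Matrix.smul_mul]

theorem Matrix.smul_shifted_inv (hs : IsUnit (s • (1 : Matrix n n K) - A)) :
    s • (s • (1 : Matrix n n K) - A)⁻¹ = 1 + (s • (1 : Matrix n n K) - A)⁻¹ * A := by
  rw [Matrix.isUnit_iff_isUnit_det] at hs
  have h := Matrix.nonsing_inv_mul _ hs
  rw [mul_sub, Matrix.mul_smul, mul_one] at h
  exact sub_eq_iff_eq_add.mp h

theorem Matrix.smul_shifted_inv_sub_smul_inv (hs : IsUnit (s • (1 : Matrix n n K) - A))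
    (ht : IsUnit (t • (1 : Matrix n n K) - A)) :
    s • (s • (1 : Matrix n n K) - A)⁻¹ - t • (t • (1 : Matrix n n K) - A)⁻¹ =
      (t - s) • (((s • (1 : Matrix n n K) - A) * (t • (1 : Matrix n n K) - A))⁻¹ * A) := by
  rw [Matrix.smul_shifted_inv hs, Matrix.smul_shifted_inv ht, add_sub_add_left_eq_sub,
    ← sub_mul, Matrix.shifted_inv_sub_inv hs ht, Matrix.smul_mul]

end ShiftedInverse

theorem stmt10 {n : ℕ}
    (A : Matrix (Fin n) (Fin n) ℝ) (B : Matrix (Fin n) (Fin 1) ℝ) (C : Matrix (Fin 1) (Fin n) ℝ)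
    (s₁ s₂ : ℂ) (hne : s₁ ≠ s₂)
    (h₁ : IsUnit (s₁ • (1 : Matrix (Fin n) (Fin n) ℂ) - A.map Complex.ofReal))
    (h₂ : IsUnit (s₂ • (1 : Matrix (Fin n) (Fin n) ℂ) - A.map Complex.ofReal))
    (g₁ g₂ : ℂ)
    (hg₁ : g₁ = ((C.map Complex.ofReal) *
      (s₁ • (1 : Matrix (Fin n) (Fin n) ℂ) - A.map Complex.ofReal)⁻¹ *
      (B.map Complex.ofReal)) 0 0)
    (hg₂ : g₂ = ((C.map Complex.ofReal) *
      (s₂ • (1 : Matrix (Fin n) (Fin n) ℂ) - A.map Complex.ofReal)⁻¹ *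
      (B.map Complex.ofReal)) 0 0)
    (𝒜₂ : Matrix (Fin n) (Fin n) ℂ)
    (h𝒜₂ : 𝒜₂ = (s₁ • (1 : Matrix (Fin n) (Fin n) ℂ) - A.map Complex.ofReal) *
      (s₂ • (1 : Matrix (Fin n) (Fin n) ℂ) - A.map Complex.ofReal)) :
    2 * (s₁ + s₂) * ((s₁ * g₁ - s₂ * g₂) ^ 2 + s₁ * s₂ * (g₁ - g₂) ^ 2) / (s₂ - s₁) ^ 2
      = 2 * (s₁ + s₂) *
        (((C.map Complex.ofReal) * 𝒜₂⁻¹ *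
          ((s₁ * s₂) • ((B.map Complex.ofReal) * (B.map Complex.ofReal)ᵀ)
            + (A.map Complex.ofReal) * (B.map Complex.ofReal) * (B.map Complex.ofReal)ᵀ *
              (A.map Complex.ofReal)ᵀ) *
          (𝒜₂⁻¹)ᵀ * (C.map Complex.ofReal)ᵀ) 0 0) := by
  have hp : g₁ - g₂ = (s₂ - s₁) *
      (C.map Complex.ofReal * 𝒜₂⁻¹ * B.map Complex.ofReal) 0 0 := by
    rw [hg₁, hg₂, h𝒜₂, ← Matrix.sub_apply, ← Matrix.sub_mul, ← Matrix.mul_sub,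
      Matrix.shifted_inv_sub_inv h₁ h₂, Matrix.mul_smul, Matrix.smul_mul, Matrix.smul_apply,
      smul_eq_mul]
  have hq : s₁ * g₁ - s₂ * g₂ = (s₂ - s₁) *
      (C.map Complex.ofReal * 𝒜₂⁻¹ * A.map Complex.ofReal * B.map Complex.ofReal) 0 0 := by
    have h := congrArg (fun X => (C.map Complex.ofReal * X * B.map Complex.ofReal) 0 0)
      (Matrix.smul_shifted_inv_sub_smul_inv h₁ h₂)
    simp only [Matrix.mul_sub, Matrix.sub_mul, Matrix.mul_smul, Matrix.smul_mul,
      Matrix.sub_apply, Matrix.smul_apply, smul_eq_mul, ← h𝒜₂, ← hg₁, ← hg₂] at h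
    rw [h, Matrix.mul_assoc (C.map Complex.ofReal) 𝒜₂⁻¹]
  have hd : s₂ - s₁ ≠ 0 := sub_ne_zero.mpr hne.symm
  rw [hp, hq]
  generalize A.map Complex.ofReal = A'
  generalize B.map Complex.ofReal = B'
  generalize C.map Complex.ofReal = C'
  generalize 𝒜₂⁻¹ = P
  have hr : C' * P * ((s₁ * s₂) • (B' * B'ᵀ) + A' * B' * B'ᵀ * A'ᵀ) * Pᵀ * C'ᵀ =
      (s₁ * s₂) • ((C' * P * B') * (C' * P * B')ᵀ) +
        (C' * P * A' * B') * (C' * P * A' * B')ᵀ := by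
    simp only [Matrix.transpose_mul, Matrix.mul_add, Matrix.add_mul, Matrix.mul_smul,
      Matrix.smul_mul, Matrix.mul_assoc]
  have hsq : ∀ X : Matrix (Fin 1) (Fin 1) ℂ, (X * Xᵀ) 0 0 = X 0 0 ^ 2 := fun X => by
    rw [Matrix.mul_apply, Fin.sum_univ_one, Matrix.transpose_apply, sq]
  rw [hr, Matrix.add_apply, Matrix.smul_apply, hsq, hsq, smul_eq_mul]
  field_simp
  ring
end
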